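/- Let U ⊆ ℝ^n and V ⊆ ℝ^m be open, X ⊆ U and Y ⊆ V relatively closed, and φ: U → V smooth with φ(X) ⊆ Y. Then for every m' ∈ ℕ ∪ {∞} the formal pullback φ^♯ maps Whitney functions to Whitney functions: if F is a Whitney function of order m' on Y, then φ^♯ F (truncated to order m' when m' is finite) is a Whitney function of order m' on X. -/

import Mathlib

noncomputable section

/-- The first-order partial derivative `∂f/∂xᵢ`. -/
def pd {n : ℕ} (i : Fin n) (f : (Fin n → ℝ) → ℝ) : (Fin n → ℝ) → ℝ :=
  fun x => fderiv ℝ f x (Pi.single i 1)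

/-- The iterated partial derivative `(∂/∂xᵢ)^k`. -/
def pdIter {n : ℕ} (i : Fin n) : ℕ → ((Fin n → ℝ) → ℝ) → ((Fin n → ℝ) → ℝ)
  | 0, f => f
  | k+1, f => pd i (pdIter i k f)

/-- The partial derivative `∂^α` for a multi-index `α ∈ ℕ^n`. -/
def mpd {n : ℕ} (α : Fin n → ℕ) (f : (Fin n → ℝ) → ℝ) : (Fin n → ℝ) → ℝ :=
  (List.ofFn fun i : Fin n => pdIter i (α i)).foldr (fun t acc => t ∘ acc) id f

/-- The total degree `|α|` of a multi-index. -/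
def mdeg {n : ℕ} (α : Fin n → ℕ) : ℕ := ∑ i, α i

/-- A jet (of infinite order) on a subset of `ℝ^n`: a family of functions indexed by
multi-indices.  (The continuity of the components on the given subset is imposed
separately.) -/
abbrev Jet (n : ℕ) := (Fin n → ℕ) → (Fin n → ℝ) → ℝ
/-- The Taylor polynomial `T^k_a F` of order `k` of a jet `F` at `a`:
`T^k_a F (x) = Σ_{|α| ≤ k} ((x-a)^α / α!) F_α(a)`. -/
def jetTaylorPoly {n : ℕ} (k : ℕ) (a : Fin n → ℝ) (F : Jet n) : (Fin n → ℝ) → ℝ :=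
  fun x => ∑ α : Fin n → Fin (k + 1),
    if mdeg (fun i => (α i : ℕ)) ≤ k then
      (∏ i, (x i - a i) ^ ((α i : ℕ))) / (∏ i, Nat.factorial (α i)) * F (fun i => (α i : ℕ)) a
    else 0

/-- The Taylor remainder `R^k_a F := F - J^k(T^k_a F)` of a jet `F` at `a`
(its components for `|α| ≤ k` are the relevant ones). -/
def jetRem {n : ℕ} (k : ℕ) (a : Fin n → ℝ) (F : Jet n) : Jet n :=
  fun α x => F α x - mpd α (jetTaylorPoly k a F) x

/-- The Whitney condition of order `k` for a jet `F` on a set `S`: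
for every compact `K ⊆ S` and `|α| ≤ k`, `(R^k_x F)_α (y) = o(|x-y|^{k-|α|})`
uniformly for `x, y ∈ K` as `|x - y| → 0`. -/
def WhitneyCond {n : ℕ} (k : ℕ) (S : Set (Fin n → ℝ)) (F : Jet n) : Prop :=
  ∀ K : Set (Fin n → ℝ), K ⊆ S → IsCompact K →
    ∀ α : Fin n → ℕ, mdeg α ≤ k →
      ∀ ε > 0, ∃ δ > 0, ∀ x ∈ K, ∀ y ∈ K, x ≠ y → dist x y < δ →
        |jetRem k x F α y| ≤ ε * dist x y ^ (k - mdeg α)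

/-- `F` is a Whitney function of order `m' ∈ ℕ ∪ {∞}` on `S`: for finite `m'` this is the
Whitney condition of order `m'`, and for `m' = ∞` it is the Whitney condition of every
finite order (i.e. every finite-order truncation is a Whitney function of that order). -/
def IsWhitneyOn {n : ℕ} (m' : ℕ∞) (S : Set (Fin n → ℝ)) (F : Jet n) : Prop :=
  ∀ k : ℕ, ((k : ℕ∞) = m' ∨ m' = ⊤) → WhitneyCond k S F

/-- The formal pullback `φ^♯` of a jet along a smooth map `φ`, given by the formula of
Faà di Bruno:
`(φ^♯F)_β = Σ_{λ ∈ Λ_{n,m}(β)} (β!/λ!) (F_{Σ_α λ_α} ∘ φ) Π_{α} (∂^α φ)^{λ_α}/(α!)^{Σ_i λ_{i,α}}`.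
Here the finitely supported maps `λ : {1,…,m} × (ℕ^n \ {0}) → ℕ` with `Σ λ_{i,α} α = β`
are encoded as functions `Fin m → (Fin n → Fin (|β|+1)) → Fin (|β|+1)` vanishing at `α = 0`
(every solution `λ` of the constraint is supported on multi-indices `α ≤ β` with values
`≤ |β|`, so this encoding is faithful). -/
def formalPullback {n m : ℕ} (φ : (Fin n → ℝ) → (Fin m → ℝ)) (F : Jet m) : Jet n :=
  fun β x =>
    ∑ lam : Fin m → (Fin n → Fin (mdeg β + 1)) → Fin (mdeg β + 1),
      if (∀ i a, (∀ j, (a j : ℕ) = 0) → (lam i a : ℕ) = 0)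
          ∧ (∀ j : Fin n,
              (∑ i, ∑ a : Fin n → Fin (mdeg β + 1), (lam i a : ℕ) * (a j : ℕ)) = β j) then
        ((∏ j, Nat.factorial (β j) : ℕ) : ℝ)
            / ((∏ i, ∏ a : Fin n → Fin (mdeg β + 1), Nat.factorial (lam i a) : ℕ) : ℝ)
          * F (fun i => ∑ a : Fin n → Fin (mdeg β + 1), (lam i a : ℕ)) (φ x)
          * ∏ a : Fin n → Fin (mdeg β + 1),
              (∏ i, (mpd (fun j => (a j : ℕ)) (fun y => φ y i) x) ^ ((lam i a : ℕ)))
                / ((∏ j, Nat.factorial (a j) : ℕ) : ℝ) ^ (∑ i, (lam i a : ℕ))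
      else 0

open scoped ContDiff Topology

section PartialDerivatives

variable {n m : ℕ}

lemma contDiff_pd {f : (Fin n → ℝ) → ℝ} (hf : ContDiff ℝ ∞ f) (i : Fin n) :
    ContDiff ℝ ∞ (pd i f) :=
  (hf.fderiv_right (m := ∞) (by simp)).clm_apply contDiff_const

lemma ContDiff.differentiableAt_of_infty {E F : Type*} [NormedAddCommGroup E] [NormedSpace ℝ E]
    [NormedAddCommGroup F] [NormedSpace ℝ F] {f : E → F} (hf : ContDiff ℝ ∞ f) (x : E) :
    DifferentiableAt ℝ f x :=
  hf.differentiable (by simp) x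

lemma pd_pd {f : (Fin n → ℝ) → ℝ} (hf : ContDiff ℝ ∞ f) (i j : Fin n) (x : Fin n → ℝ) :
    pd i (pd j f) x = fderiv ℝ (fderiv ℝ f) x (Pi.single i 1) (Pi.single j 1) := by
  have h := ((hf.fderiv_right (m := ∞) (by simp)).differentiableAt_of_infty x)
  have := (h.hasFDerivAt.clm_apply (hasFDerivAt_const (Pi.single j 1 : Fin n → ℝ) x)).fderiv
  unfold pd
  rw [this]
  simp

lemma pd_comm {f : (Fin n → ℝ) → ℝ} (hf : ContDiff ℝ ∞ f) (i j : Fin n) :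
    pd i (pd j f) = pd j (pd i f) := by
  ext x
  rw [pd_pd hf, pd_pd hf]
  exact (hf.contDiffAt.isSymmSndFDerivAt (by
    rw [minSmoothness_of_isRCLikeNormedField]
    exact WithTop.coe_le_coe.2 (OrderTop.le_top (2 : ℕ∞)))) _ _

lemma pd_sum {ι : Type*} (s : Finset ι) {f : ι → (Fin n → ℝ) → ℝ}
    (hf : ∀ j ∈ s, ContDiff ℝ ∞ (f j)) (i : Fin n) :
    pd i (fun x => ∑ j ∈ s, f j x) = fun x => ∑ j ∈ s, pd i (f j) x := by
  ext x
  unfold pd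
  rw [fderiv_fun_sum fun j hj => (hf j hj).differentiableAt_of_infty x]
  simp

lemma pd_const_mul {f : (Fin n → ℝ) → ℝ} (hf : ContDiff ℝ ∞ f) (c : ℝ) (i : Fin n) :
    pd i (fun x => c * f x) = fun x => c * pd i f x := by
  ext x
  unfold pd
  rw [fderiv_const_mul (hf.differentiableAt_of_infty x)]
  simp

lemma pd_sub {f g : (Fin n → ℝ) → ℝ} (hf : ContDiff ℝ ∞ f) (hg : ContDiff ℝ ∞ g) (i : Fin n) :
    pd i (fun x => f x - g x) = fun x => pd i f x - pd i g x := by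
  ext x
  unfold pd
  rw [fderiv_fun_sub (hf.differentiableAt_of_infty x) (hg.differentiableAt_of_infty x)]
  simp

lemma pd_mul {f g : (Fin n → ℝ) → ℝ} (hf : ContDiff ℝ ∞ f) (hg : ContDiff ℝ ∞ g) (i : Fin n) :
    pd i (fun x => f x * g x) = fun x => f x * pd i g x + pd i f x * g x := by
  ext x
  unfold pd
  rw [fderiv_fun_mul (hf.differentiableAt_of_infty x) (hg.differentiableAt_of_infty x)]
  simp [mul_comm]

lemma pd_comp {G : (Fin m → ℝ) → ℝ} {φ : (Fin n → ℝ) → (Fin m → ℝ)} (hG : ContDiff ℝ ∞ G)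
    (hφ : ContDiff ℝ ∞ φ) (i : Fin n) :
    pd i (fun x => G (φ x)) = fun x => ∑ j, pd j G (φ x) * pd i (fun y => φ y j) x := by
  ext x
  have h1 := (hG.differentiableAt_of_infty (φ x)).hasFDerivAt
  have h2 := (hφ.differentiableAt_of_infty x).hasFDerivAt
  have h3 : ∀ j, fderiv ℝ (fun y => φ y j) x (Pi.single i 1) = fderiv ℝ φ x (Pi.single i 1) j := by
    intro j
    rw [(hasFDerivAt_pi'.1 h2 j).fderiv]
    simp
  have h4 : HasFDerivAt (fun x => G (φ x)) ((fderiv ℝ G (φ x)).comp (fderiv ℝ φ x)) x :=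
    h1.comp x h2
  unfold pd
  rw [h4.fderiv]
  simp only [h3, ContinuousLinearMap.comp_apply]
  conv_lhs => rw [pi_eq_sum_univ' (fderiv ℝ φ x (Pi.single i 1))]
  rw [map_sum]
  refine Finset.sum_congr rfl fun j _ => ?_
  rw [map_smul, smul_eq_mul, mul_comm]

lemma pd_congr_nhds {f g : (Fin n → ℝ) → ℝ} {x : Fin n → ℝ} (h : f =ᶠ[𝓝 x] g) (i : Fin n) :
    pd i f =ᶠ[𝓝 x] pd i g := by
  filter_upwards [h.fderiv (𝕜 := ℝ)] with y hy
  simp only [pd, hy]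

lemma contDiff_pdIter {f : (Fin n → ℝ) → ℝ} (hf : ContDiff ℝ ∞ f) (i : Fin n) (k : ℕ) :
    ContDiff ℝ ∞ (pdIter i k f) := by
  induction k with
  | zero => exact hf
  | succ k ih => exact contDiff_pd ih i

lemma pd_pdIter {f : (Fin n → ℝ) → ℝ} (hf : ContDiff ℝ ∞ f) (i j : Fin n) (k : ℕ) :
    pd i (pdIter j k f) = pdIter j k (pd i f) := by
  induction k with
  | zero => rfl
  | succ k ih => rw [pdIter, pdIter, pd_comm (contDiff_pdIter hf j k), ih]

lemma pdIter_congr_nhds {f g : (Fin n → ℝ) → ℝ} {x : Fin n → ℝ} (h : f =ᶠ[𝓝 x] g) (i : Fin n)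
    (k : ℕ) : pdIter i k f =ᶠ[𝓝 x] pdIter i k g := by
  induction k with
  | zero => exact h
  | succ k ih => exact pd_congr_nhds ih i

/-- The iterated partial derivative `∂^α` restricted to the variables in a list. -/
def listPd (l : List (Fin n)) (α : Fin n → ℕ) (f : (Fin n → ℝ) → ℝ) : (Fin n → ℝ) → ℝ :=
  l.foldr (fun i g => pdIter i (α i) g) f

lemma mpd_eq_listPd (α : Fin n → ℕ) (f : (Fin n → ℝ) → ℝ) :
    mpd α f = listPd (List.finRange n) α f := by
  unfold mpd listPd
  rw [List.ofFn_eq_map]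
  induction List.finRange n with
  | nil => rfl
  | cons i l ih => simpa using congrArg (pdIter i (α i)) ih

lemma contDiff_listPd {f : (Fin n → ℝ) → ℝ} (hf : ContDiff ℝ ∞ f) (l : List (Fin n))
    (α : Fin n → ℕ) : ContDiff ℝ ∞ (listPd l α f) := by
  induction l with
  | nil => exact hf
  | cons i l ih => exact contDiff_pdIter ih i _

lemma pd_listPd {f : (Fin n → ℝ) → ℝ} (hf : ContDiff ℝ ∞ f) (l : List (Fin n))
    (α : Fin n → ℕ) (i : Fin n) : pd i (listPd l α f) = listPd l α (pd i f) := by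
  induction l with
  | nil => rfl
  | cons j l ih =>
    change pd i (pdIter j (α j) (listPd l α f)) = pdIter j (α j) (listPd l α (pd i f))
    rw [pd_pdIter (contDiff_listPd hf l α), ih]

lemma listPd_add_single_of_notMem (l : List (Fin n)) (α : Fin n → ℕ) {i : Fin n} (hi : i ∉ l)
    (f : (Fin n → ℝ) → ℝ) : listPd l (α + Pi.single i 1) f = listPd l α f := by
  induction l with
  | nil => rfl
  | cons j l ih =>
    rw [List.mem_cons, not_or] at hi
    change pdIter j _ (listPd l _ f) = pdIter j _ (listPd l α f)
    rw [ih hi.2]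
    simp [Pi.single_eq_of_ne (Ne.symm hi.1)]

lemma listPd_add_single {f : (Fin n → ℝ) → ℝ} (hf : ContDiff ℝ ∞ f) (l : List (Fin n))
    (hl : l.Nodup) (α : Fin n → ℕ) {i : Fin n} (hi : i ∈ l) :
    listPd l (α + Pi.single i 1) f = pd i (listPd l α f) := by
  induction l with
  | nil => simp at hi
  | cons j l ih =>
    rw [List.nodup_cons] at hl
    change pdIter j _ (listPd l _ f) = pd i (pdIter j _ (listPd l α f))
    by_cases hij : i = j
    · subst hij
      rw [listPd_add_single_of_notMem l α hl.1]
      simp [pdIter]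
    · have hil : i ∈ l := (List.mem_cons.1 hi).resolve_left hij
      rw [ih hl.2 hil, pd_pdIter (contDiff_listPd hf l α)]
      simp [Pi.single_eq_of_ne (Ne.symm hij)]

lemma contDiff_mpd {f : (Fin n → ℝ) → ℝ} (hf : ContDiff ℝ ∞ f) (α : Fin n → ℕ) :
    ContDiff ℝ ∞ (mpd α f) := by
  rw [mpd_eq_listPd]
  exact contDiff_listPd hf _ α

lemma mpd_zero (f : (Fin n → ℝ) → ℝ) : mpd 0 f = f := by
  rw [mpd_eq_listPd, listPd]
  induction List.finRange n with
  | nil => rfl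
  | cons i l ih => exact ih

lemma mpd_add_single {f : (Fin n → ℝ) → ℝ} (hf : ContDiff ℝ ∞ f) (α : Fin n → ℕ) (i : Fin n) :
    mpd (α + Pi.single i 1) f = pd i (mpd α f) := by
  rw [mpd_eq_listPd, mpd_eq_listPd,
    listPd_add_single hf _ (List.nodup_finRange n) α (List.mem_finRange i)]

lemma mpd_add_single' {f : (Fin n → ℝ) → ℝ} (hf : ContDiff ℝ ∞ f) (α : Fin n → ℕ) (i : Fin n) :
    mpd (α + Pi.single i 1) f = mpd α (pd i f) := by
  rw [mpd_add_single hf, mpd_eq_listPd, mpd_eq_listPd, pd_listPd hf]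

lemma mpd_congr_nhds {f g : (Fin n → ℝ) → ℝ} {x : Fin n → ℝ} (h : f =ᶠ[𝓝 x] g)
    (α : Fin n → ℕ) : mpd α f =ᶠ[𝓝 x] mpd α g := by
  rw [mpd_eq_listPd, mpd_eq_listPd]
  induction List.finRange n with
  | nil => exact h
  | cons i l ih => exact pdIter_congr_nhds ih i _

lemma mdeg_add (α β : Fin n → ℕ) : mdeg (α + β) = mdeg α + mdeg β := by
  simp [mdeg, Finset.sum_add_distrib]

lemma mdeg_single (i : Fin n) : mdeg (Pi.single i 1) = 1 := by
  simp [mdeg]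

lemma mdeg_eq_zero {α : Fin n → ℕ} : mdeg α = 0 ↔ α = 0 := by
  simp [mdeg, funext_iff]

lemma le_mdeg (α : Fin n → ℕ) (i : Fin n) : α i ≤ mdeg α :=
  Finset.single_le_sum (fun _ _ => Nat.zero_le _) (Finset.mem_univ i)

lemma sub_single_add_single {α : Fin n → ℕ} {i : Fin n} (hi : α i ≠ 0) :
    α - Pi.single i 1 + Pi.single i 1 = α := by
  refine tsub_add_cancel_of_le fun j => ?_
  by_cases hij : j = i
  · subst hij
    simpa using Nat.one_le_iff_ne_zero.2 hi
  · simp [Pi.single_eq_of_ne hij]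

lemma exists_eq_add_single {α : Fin n → ℕ} (h : α ≠ 0) :
    ∃ (i : Fin n) (β : Fin n → ℕ), α = β + Pi.single i 1 := by
  obtain ⟨i, hi⟩ := Function.ne_iff.1 h
  exact ⟨i, α - Pi.single i 1, (sub_single_add_single hi).symm⟩

lemma multiIndex_induction {P : (Fin n → ℕ) → Prop} (h0 : P 0)
    (hs : ∀ α i, P α → P (α + Pi.single i 1)) (α : Fin n → ℕ) : P α := by
  induction hk : mdeg α generalizing α with
  | zero => rwa [mdeg_eq_zero.1 hk]
  | succ k ih =>
    obtain ⟨i, β, rfl⟩ := exists_eq_add_single (α := α) (by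
      rintro rfl
      simp [mdeg] at hk)
    rw [mdeg_add, mdeg_single] at hk
    exact hs β i (ih β (by lia))

lemma mpd_add {f : (Fin n → ℝ) → ℝ} (hf : ContDiff ℝ ∞ f) (α β : Fin n → ℕ) :
    mpd (α + β) f = mpd α (mpd β f) := by
  induction α using multiIndex_induction with
  | h0 => rw [zero_add, mpd_zero]
  | hs α i ih =>
    rw [add_right_comm, mpd_add_single hf, ih, mpd_add_single (contDiff_mpd hf β)]

lemma mpd_sum_const_mul {ι : Type*} (s : Finset ι) (c : ι → ℝ) {f : ι → (Fin n → ℝ) → ℝ}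
    (hf : ∀ j ∈ s, ContDiff ℝ ∞ (f j)) (α : Fin n → ℕ) :
    mpd α (fun x => ∑ j ∈ s, c j * f j x) = fun x => ∑ j ∈ s, c j * mpd α (f j) x := by
  have hc : ∀ {g : ι → (Fin n → ℝ) → ℝ}, (∀ j ∈ s, ContDiff ℝ ∞ (g j)) →
      ∀ j ∈ s, ContDiff ℝ ∞ (fun x => c j * g j x) :=
    fun hg j hj => contDiff_const.mul (hg j hj)
  induction α using multiIndex_induction with
  | h0 => simp only [mpd_zero]
  | hs α i ih =>
    rw [mpd_add_single (ContDiff.sum (hc hf)), ih,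
      pd_sum s (hc fun j hj => contDiff_mpd (hf j hj) α)]
    ext x
    refine Finset.sum_congr rfl fun j hj => ?_
    rw [pd_const_mul (contDiff_mpd (hf j hj) α), mpd_add_single (hf j hj)]

end PartialDerivatives

section TaylorPolynomials

variable {n : ℕ}

/-- The normalized monomial `(x - a)^α / α!`. -/
def taylorMonomial (a : Fin n → ℝ) (α : Fin n → ℕ) (x : Fin n → ℝ) : ℝ :=
  ∏ i, (x i - a i) ^ α i / (Nat.factorial (α i) : ℝ)

lemma contDiff_taylorMonomial (a : Fin n → ℝ) (α : Fin n → ℕ) :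
    ContDiff ℝ ∞ (taylorMonomial a α) := by
  unfold taylorMonomial
  fun_prop

lemma taylorMonomial_self (a : Fin n → ℝ) (α : Fin n → ℕ) :
    taylorMonomial a α a = if α = 0 then 1 else 0 := by
  unfold taylorMonomial
  split_ifs with h
  · simp [h]
  · obtain ⟨i, hi⟩ := Function.ne_iff.1 h
    refine Finset.prod_eq_zero (Finset.mem_univ i) ?_
    rw [sub_self, zero_pow hi, zero_div]

lemma taylorMonomial_zero (a : Fin n → ℝ) : taylorMonomial a 0 = fun _ => 1 := by
  ext x
  simp [taylorMonomial]

lemma pd_taylorMonomial (a : Fin n → ℝ) (α : Fin n → ℕ) (i : Fin n) (x : Fin n → ℝ) :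
    pd i (taylorMonomial a α) x =
      (α i * (x i - a i) ^ (α i - 1) / (Nat.factorial (α i) : ℝ)) *
        ∏ j ∈ Finset.univ.erase i, (x j - a j) ^ α j / (Nat.factorial (α j) : ℝ) := by
  have h : ∀ j : Fin n, HasFDerivAt
      (fun x : Fin n → ℝ => (x j - a j) ^ α j / (Nat.factorial (α j) : ℝ))
      ((α j * (x j - a j) ^ (α j - 1) / (Nat.factorial (α j) : ℝ)) •
        (ContinuousLinearMap.proj j : (Fin n → ℝ) →L[ℝ] ℝ)) x := by
    intro j
    have h1 := (((ContinuousLinearMap.proj j : (Fin n → ℝ) →L[ℝ] ℝ).hasFDerivAt (x := x)).sub_const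
      (a j)).pow (α j)
    have h2 := h1.mul_const ((Nat.factorial (α j) : ℝ)⁻¹)
    refine (h2.congr_fderiv ?_)
    ext v
    simp
    ring
  have hp := HasFDerivAt.finsetProd (u := Finset.univ) fun j _ => h j
  unfold pd
  rw [show taylorMonomial a α = fun x => ∏ j, (x j - a j) ^ α j / (Nat.factorial (α j) : ℝ)
    from rfl, hp.fderiv, sum_apply, Finset.sum_eq_single i]
  · simp
    ring
  · intro j _ hj
    simp [Pi.single_eq_of_ne hj]
  · simp

lemma pd_taylorMonomial_of_eq_zero (a : Fin n → ℝ) {α : Fin n → ℕ} {i : Fin n} (h : α i = 0) :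
    pd i (taylorMonomial a α) = fun _ => 0 := by
  ext x
  rw [pd_taylorMonomial, h]
  simp

lemma pd_taylorMonomial_add_single (a : Fin n → ℝ) (α : Fin n → ℕ) (i : Fin n) :
    pd i (taylorMonomial a (α + Pi.single i 1)) = taylorMonomial a α := by
  ext x
  rw [pd_taylorMonomial, taylorMonomial, ← Finset.mul_prod_erase _ _ (Finset.mem_univ i)]
  congr 1
  · simp [Nat.factorial_succ]
    field_simp
  · refine Finset.prod_congr rfl fun j hj => ?_
    simp [Pi.single_eq_of_ne (Finset.ne_of_mem_erase hj)]

lemma mpd_taylorMonomial_self (a : Fin n → ℝ) (α β : Fin n → ℕ) :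
    mpd β (taylorMonomial a α) a = if α = β then 1 else 0 := by
  induction β using multiIndex_induction generalizing α with
  | h0 => rw [mpd_zero, taylorMonomial_self]
  | hs β i ih =>
    rw [mpd_add_single' (contDiff_taylorMonomial a α)]
    by_cases h : α i = 0
    · rw [pd_taylorMonomial_of_eq_zero a h, if_neg]
      · have := mpd_sum_const_mul (∅ : Finset (Fin n)) (fun _ => 0)
          (f := fun _ => taylorMonomial a α) (by simp) β
        simp only [Finset.sum_empty] at this
        rw [this]
      · rintro rfl
        simp at h
    · obtain ⟨α, rfl⟩ : ∃ γ : Fin n → ℕ, α = γ + Pi.single i 1 :=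
        ⟨_, (sub_single_add_single h).symm⟩
      rw [pd_taylorMonomial_add_single, ih]
      simp only [add_left_inj]

/-- The multi-indices of degree at most `k`. -/
def multiIndices (n k : ℕ) : Finset (Fin n → ℕ) :=
  (Fintype.piFinset fun _ => Finset.range (k + 1)).filter fun α => mdeg α ≤ k

lemma mem_multiIndices {k : ℕ} {α : Fin n → ℕ} : α ∈ multiIndices n k ↔ mdeg α ≤ k := by
  simp only [multiIndices, Finset.mem_filter, Fintype.mem_piFinset, Finset.mem_range,
    Nat.lt_succ_iff, and_iff_right_iff_imp]
  exact fun h i => (le_mdeg α i).trans h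

lemma jetTaylorPoly_eq_sum (k : ℕ) (a : Fin n → ℝ) (F : Jet n) :
    jetTaylorPoly k a F = fun x => ∑ α ∈ multiIndices n k, F α a * taylorMonomial a α x := by
  ext x
  unfold jetTaylorPoly
  rw [← Finset.sum_filter]
  refine Finset.sum_bij (fun α _ i => (α i : ℕ)) ?_ ?_ ?_ ?_
  · intro α hα
    exact mem_multiIndices.2 (Finset.mem_filter.1 hα).2
  · intro α _ β _ h
    exact funext fun i => Fin.ext (congrFun h i)
  · intro β hβ
    rw [mem_multiIndices] at hβ
    refine ⟨fun i => ⟨β i, Nat.lt_succ_of_le ((le_mdeg β i).trans hβ)⟩, ?_, rfl⟩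
    simpa using hβ
  · intro α _
    rw [taylorMonomial, Finset.prod_div_distrib]
    push_cast
    ring

lemma contDiff_jetTaylorPoly (k : ℕ) (a : Fin n → ℝ) (F : Jet n) :
    ContDiff ℝ ∞ (jetTaylorPoly k a F) := by
  rw [jetTaylorPoly_eq_sum]
  exact ContDiff.sum fun α _ => contDiff_const.mul (contDiff_taylorMonomial a α)

lemma jetTaylorPoly_congr {k : ℕ} {a : Fin n → ℝ} {F G : Jet n}
    (h : ∀ α, mdeg α ≤ k → F α a = G α a) : jetTaylorPoly k a F = jetTaylorPoly k a G := by
  rw [jetTaylorPoly_eq_sum, jetTaylorPoly_eq_sum]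
  ext x
  exact Finset.sum_congr rfl fun α hα => by rw [h α (mem_multiIndices.1 hα)]

lemma mpd_jetTaylorPoly_self {k : ℕ} (a : Fin n → ℝ) (F : Jet n) {β : Fin n → ℕ}
    (hβ : mdeg β ≤ k) : mpd β (jetTaylorPoly k a F) a = F β a := by
  rw [jetTaylorPoly_eq_sum, mpd_sum_const_mul _ _ fun α _ => contDiff_taylorMonomial a α]
  simp [mpd_taylorMonomial_self, mem_multiIndices, hβ]

lemma jetTaylorPoly_self (k : ℕ) (a : Fin n → ℝ) (F : Jet n) :
    jetTaylorPoly k a F a = F 0 a := by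
  have := mpd_jetTaylorPoly_self (k := k) a F (β := 0) (by simp [mdeg])
  rwa [mpd_zero] at this

lemma jetTaylorPoly_zero (a : Fin n → ℝ) (F : Jet n) :
    jetTaylorPoly 0 a F = fun _ => F 0 a := by
  have h : multiIndices n 0 = {0} := by
    ext α
    rw [mem_multiIndices, Nat.le_zero, mdeg_eq_zero, Finset.mem_singleton]
  rw [jetTaylorPoly_eq_sum, h]
  simp [taylorMonomial_zero]

lemma pd_jetTaylorPoly_succ (k : ℕ) (a : Fin n → ℝ) (F : Jet n) (i : Fin n) :
    pd i (jetTaylorPoly (k + 1) a F) =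
      jetTaylorPoly k a (fun α => F (α + Pi.single i 1)) := by
  rw [jetTaylorPoly_eq_sum, jetTaylorPoly_eq_sum,
    pd_sum _ fun α _ => contDiff_const.mul (contDiff_taylorMonomial a α)]
  ext x
  simp only [pd_const_mul (contDiff_taylorMonomial a _)]
  symm
  refine Finset.sum_of_injOn (fun α => α + Pi.single i 1) ?_ ?_ ?_ ?_
  · exact fun α _ β _ h => add_right_cancel h
  · intro α hα
    rw [Finset.mem_coe, mem_multiIndices] at hα ⊢
    rw [mdeg_add, mdeg_single]
    lia
  · intro α hα h
    rw [pd_taylorMonomial_of_eq_zero, mul_zero]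
    by_contra hi
    refine h ⟨α - Pi.single i 1, ?_⟩
    have hα' := sub_single_add_single hi
    refine ⟨?_, hα'⟩
    rw [mem_multiIndices, ← hα', mdeg_add, mdeg_single] at hα
    rw [Finset.mem_coe, mem_multiIndices]
    lia
  · intro α _
    simp only [pd_taylorMonomial_add_single]

lemma mpd_jetTaylorPoly {k : ℕ} (a : Fin n → ℝ) (F : Jet n) {β : Fin n → ℕ}
    (hβ : mdeg β ≤ k) :
    mpd β (jetTaylorPoly k a F) = jetTaylorPoly (k - mdeg β) a (fun α => F (α + β)) := by
  induction β using multiIndex_induction generalizing k F with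
  | h0 => simp [mpd_zero, mdeg]
  | hs β i ih =>
    rw [mdeg_add, mdeg_single] at hβ
    obtain ⟨k, rfl⟩ : ∃ l, k = l + 1 := ⟨k - 1, by lia⟩
    rw [mpd_add_single' (contDiff_jetTaylorPoly _ a F), pd_jetTaylorPoly_succ,
      ih _ (by lia), mdeg_add, mdeg_single, Nat.add_sub_add_right]
    simp only [add_assoc]

end TaylorPolynomials

section TaylorTheorem

variable {n : ℕ}

lemma norm_fderiv_le_sum_pd (f : (Fin n → ℝ) → ℝ) (x : Fin n → ℝ) :
    ‖fderiv ℝ f x‖ ≤ ∑ i, |pd i f x| := by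
  refine ContinuousLinearMap.opNorm_le_bound _ (by positivity) fun v => ?_
  conv_lhs => rw [pi_eq_sum_univ' v]
  rw [map_sum, Finset.sum_mul]
  refine (norm_sum_le _ _).trans (Finset.sum_le_sum fun i _ => ?_)
  rw [map_smul, norm_smul, mul_comm]
  refine mul_le_mul (le_of_eq ?_) (norm_le_pi_norm v i) (norm_nonneg _) (abs_nonneg _)
  rw [Real.norm_eq_abs, pd]

/-- Taylor's theorem with Peano remainder, uniformly over a compact set of base points. -/
lemma taylor_uniform {K : Set (Fin n → ℝ)} (hK : IsCompact K) (k : ℕ)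
    {f : (Fin n → ℝ) → ℝ} (hf : ContDiff ℝ ∞ f) {ε : ℝ} (hε : 0 < ε) :
    ∃ δ > 0, ∀ x ∈ K, ∀ y, dist x y < δ →
      |f y - jetTaylorPoly k x (fun α => mpd α f) y| ≤ ε * dist x y ^ k := by
  induction k generalizing f ε with
  | zero =>
    have := hK.uniformContinuousAt_of_continuousAt f
      (fun x _ => hf.continuous.continuousAt) (Metric.dist_mem_uniformity hε)
    obtain ⟨δ, hδ, h⟩ := Metric.mem_uniformity_dist.1 this
    refine ⟨δ, hδ, fun x hx y hxy => ?_⟩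
    rw [jetTaylorPoly_zero, mpd_zero, pow_zero, mul_one, ← Real.dist_eq, dist_comm]
    exact (h hxy hx).le
  | succ k ih =>
    have hη : 0 < ε / (n + 1) := by positivity
    choose δ hδ h using fun i => ih (contDiff_pd hf i) hη
    obtain ⟨r, hr, hrδ⟩ : ∃ r > 0, ∀ i, r ≤ δ i := by
      rcases isEmpty_or_nonempty (Fin n) with hn | hn
      · exact ⟨1, one_pos, fun i => hn.elim i⟩
      · obtain ⟨i, hi⟩ := Finite.exists_min δ
        exact ⟨δ i, hδ i, hi⟩
    refine ⟨r, hr, fun x hx y hxy => ?_⟩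
    set T := jetTaylorPoly (k + 1) x (fun α => mpd α f) with hT
    have hTs : ContDiff ℝ ∞ T := contDiff_jetTaylorPoly _ _ _
    have hbound : ∀ z ∈ Metric.closedBall x (dist x y),
        ‖fderiv ℝ (fun u => f u - T u) z‖ ≤ ε * dist x y ^ k := by
      intro z hz
      rw [Metric.mem_closedBall, dist_comm] at hz
      calc ‖fderiv ℝ (fun u => f u - T u) z‖ ≤ ∑ i, |pd i (fun u => f u - T u) z| :=
            norm_fderiv_le_sum_pd _ _
        _ ≤ ∑ i : Fin n, ε / (n + 1) * dist x y ^ k := by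
            refine Finset.sum_le_sum fun i _ => ?_
            rw [pd_sub hf hTs, hT, pd_jetTaylorPoly_succ]
            simp only [mpd_add_single' hf]
            refine (h i x hx z ((hz.trans_lt hxy).trans_le (hrδ i))).trans ?_
            gcongr
        _ ≤ ε * dist x y ^ k := by
            rw [Finset.sum_const, Finset.card_univ, Fintype.card_fin, nsmul_eq_mul, ← mul_assoc]
            gcongr
            rw [mul_div_assoc', div_le_iff₀ (by positivity)]
            nlinarith
    have key := (convex_closedBall x (dist x y)).norm_image_sub_le_of_norm_fderiv_le
      (fun z _ => (hf.sub hTs).differentiableAt_of_infty z) hbound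
      (Metric.mem_closedBall_self dist_nonneg) (Metric.mem_closedBall.2 (dist_comm y x).le)
    have hx0 : f x - T x = 0 := by
      rw [hT, jetTaylorPoly_self, mpd_zero, sub_self]
    rw [hx0, sub_zero, Real.norm_eq_abs, ← dist_eq_norm, dist_comm y x] at key
    rwa [pow_succ, ← mul_assoc]

/-- The jet of a smooth function satisfies the Whitney condition on every compact set. -/
lemma whitneyCond_mpd {K : Set (Fin n → ℝ)} (hK : IsCompact K) (k : ℕ)
    {f : (Fin n → ℝ) → ℝ} (hf : ContDiff ℝ ∞ f) {β : Fin n → ℕ} (hβ : mdeg β ≤ k)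
    {ε : ℝ} (hε : 0 < ε) :
    ∃ δ > 0, ∀ x ∈ K, ∀ y, dist x y < δ →
      |jetRem k x (fun α => mpd α f) β y| ≤ ε * dist x y ^ (k - mdeg β) := by
  obtain ⟨δ, hδ, h⟩ := taylor_uniform hK (k - mdeg β) (contDiff_mpd hf β) hε
  refine ⟨δ, hδ, fun x hx y hxy => ?_⟩
  rw [jetRem, mpd_jetTaylorPoly _ _ hβ]
  simp only [mpd_add hf]
  exact h x hx y hxy

end TaylorTheorem

section JetAgreement

variable {n m : ℕ}

/-- Two functions have the same partial derivatives up to order `N` at `y`. -/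
def JetEq (N : ℕ) (y : Fin n → ℝ) (f g : (Fin n → ℝ) → ℝ) : Prop :=
  ∀ α : Fin n → ℕ, mdeg α ≤ N → mpd α f y = mpd α g y

lemma JetEq.eq {N : ℕ} {y : Fin n → ℝ} {f g : (Fin n → ℝ) → ℝ} (h : JetEq N y f g) :
    f y = g y := by
  simpa [mpd_zero] using h 0 (by simp [mdeg])

lemma JetEq.of_succ {N : ℕ} {y : Fin n → ℝ} {f g : (Fin n → ℝ) → ℝ} (h : JetEq (N + 1) y f g) :
    JetEq N y f g :=
  fun α hα => h α (hα.trans N.le_succ)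

lemma JetEq.pd {N : ℕ} {y : Fin n → ℝ} {f g : (Fin n → ℝ) → ℝ} (hf : ContDiff ℝ ∞ f)
    (hg : ContDiff ℝ ∞ g) (h : JetEq (N + 1) y f g) (i : Fin n) :
    JetEq N y (pd i f) (pd i g) := by
  intro α hα
  rw [← mpd_add_single' hf, ← mpd_add_single' hg]
  exact h _ (by rw [mdeg_add, mdeg_single]; lia)

lemma jetEq_zero {y : Fin n → ℝ} {f g : (Fin n → ℝ) → ℝ} (h : f y = g y) : JetEq 0 y f g := by
  intro α hα
  rw [mdeg_eq_zero.1 (Nat.le_zero.1 hα), mpd_zero, mpd_zero, h]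

lemma jetEq_succ {N : ℕ} {y : Fin n → ℝ} {f g : (Fin n → ℝ) → ℝ} (hf : ContDiff ℝ ∞ f)
    (hg : ContDiff ℝ ∞ g) (h : f y = g y) (hpd : ∀ i, JetEq N y (pd i f) (pd i g)) :
    JetEq (N + 1) y f g := by
  intro α hα
  by_cases h0 : α = 0
  · rw [h0, mpd_zero, mpd_zero, h]
  · obtain ⟨i, β, rfl⟩ := exists_eq_add_single h0
    rw [mpd_add_single' hf, mpd_add_single' hg]
    rw [mdeg_add, mdeg_single] at hα
    exact hpd i β (by lia)

lemma JetEq.sum {ι : Type*} {s : Finset ι} {N : ℕ} {y : Fin n → ℝ}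
    {f g : ι → (Fin n → ℝ) → ℝ} (hf : ∀ j ∈ s, ContDiff ℝ ∞ (f j))
    (hg : ∀ j ∈ s, ContDiff ℝ ∞ (g j)) (h : ∀ j ∈ s, JetEq N y (f j) (g j)) :
    JetEq N y (fun x => ∑ j ∈ s, f j x) (fun x => ∑ j ∈ s, g j x) := by
  intro α hα
  have hf' := congrFun (mpd_sum_const_mul s (fun _ => 1) hf α) y
  have hg' := congrFun (mpd_sum_const_mul s (fun _ => 1) hg α) y
  simp only [one_mul] at hf' hg'
  rw [hf', hg']
  exact Finset.sum_congr rfl fun j hj => h j hj α hα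

lemma JetEq.add {N : ℕ} {y : Fin n → ℝ} {f g f' g' : (Fin n → ℝ) → ℝ} (hf : ContDiff ℝ ∞ f)
    (hg : ContDiff ℝ ∞ g) (hf' : ContDiff ℝ ∞ f') (hg' : ContDiff ℝ ∞ g')
    (h : JetEq N y f f') (h' : JetEq N y g g') :
    JetEq N y (fun x => f x + g x) (fun x => f' x + g' x) := by
  simpa [Fin.sum_univ_two] using JetEq.sum (s := Finset.univ) (N := N) (y := y)
    (f := ![f, g]) (g := ![f', g']) (by simp [Fin.forall_fin_two, hf, hg])
    (by simp [Fin.forall_fin_two, hf', hg']) (by simp [Fin.forall_fin_two, h, h'])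

lemma JetEq.mul {N : ℕ} {y : Fin n → ℝ} {f g f' g' : (Fin n → ℝ) → ℝ} (hf : ContDiff ℝ ∞ f)
    (hg : ContDiff ℝ ∞ g) (hf' : ContDiff ℝ ∞ f') (hg' : ContDiff ℝ ∞ g')
    (h : JetEq N y f f') (h' : JetEq N y g g') :
    JetEq N y (fun x => f x * g x) (fun x => f' x * g' x) := by
  induction N generalizing f g f' g' with
  | zero => exact jetEq_zero (by rw [h.eq, h'.eq])
  | succ N ih =>
    refine jetEq_succ (hf.mul hg) (hf'.mul hg') (by rw [h.eq, h'.eq]) fun i => ?_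
    rw [pd_mul hf hg, pd_mul hf' hg']
    have hfi := contDiff_pd hf i
    have hgi := contDiff_pd hg i
    have hfi' := contDiff_pd hf' i
    have hgi' := contDiff_pd hg' i
    exact JetEq.add (hf.mul hgi) (hfi.mul hg) (hf'.mul hgi') (hfi'.mul hg')
      (ih hf hgi hf' hgi' h.of_succ (h'.pd hg hg' i))
      (ih hfi hg hfi' hg' (h.pd hf hf' i) h'.of_succ)

lemma JetEq.comp {N : ℕ} {y : Fin n → ℝ} {G H : (Fin m → ℝ) → ℝ}
    {φ ψ : (Fin n → ℝ) → (Fin m → ℝ)} (hG : ContDiff ℝ ∞ G) (hH : ContDiff ℝ ∞ H)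
    (hφ : ContDiff ℝ ∞ φ) (hψ : ContDiff ℝ ∞ ψ) (hGH : JetEq N (φ y) G H)
    (hφψ : ∀ j, JetEq N y (fun x => φ x j) (fun x => ψ x j)) :
    JetEq N y (fun x => G (φ x)) (fun x => H (ψ x)) := by
  have hy : ψ y = φ y := funext fun j => (hφψ j).eq.symm
  induction N generalizing G H with
  | zero => exact jetEq_zero (by rw [hy, hGH.eq])
  | succ N ih =>
    refine jetEq_succ (hG.comp hφ) (hH.comp hψ) (by rw [hy, hGH.eq]) fun i => ?_
    rw [pd_comp hG hφ, pd_comp hH hψ]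
    have hφj := contDiff_pi.1 hφ
    have hψj := contDiff_pi.1 hψ
    refine JetEq.sum
      (fun j _ => ((contDiff_pd hG j).comp hφ).mul (contDiff_pd (hφj j) i))
      (fun j _ => ((contDiff_pd hH j).comp hψ).mul (contDiff_pd (hψj j) i)) fun j _ => ?_
    exact JetEq.mul ((contDiff_pd hG j).comp hφ) (contDiff_pd (hφj j) i)
      ((contDiff_pd hH j).comp hψ) (contDiff_pd (hψj j) i)
      (ih (contDiff_pd hG j) (contDiff_pd hH j) (hGH.pd hG hH j) fun j => (hφψ j).of_succ)
      ((hφψ j).pd (hφj j) (hψj j) i)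

end JetAgreement

section FaaDiBruno

variable {n m : ℕ}

lemma sum_pow_div_factorial {A : Type*} [Fintype A] [DecidableEq A] (t : A → ℝ) (p : ℕ) :
    (∑ a, t a) ^ p / (p.factorial : ℝ) =
      ∑ l ∈ Finset.piAntidiag Finset.univ p, ∏ a, t a ^ l a / ((l a).factorial : ℝ) := by
  rw [Finset.sum_pow_eq_sum_piAntidiag, Finset.sum_div]
  refine Finset.sum_congr rfl fun l hl => ?_
  rw [Finset.mem_piAntidiag] at hl
  have h := Nat.multinomial_spec Finset.univ l
  rw [hl.1] at h
  rw [Finset.prod_div_distrib, ← h]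
  have h1 : (Nat.multinomial Finset.univ l : ℝ) ≠ 0 :=
    Nat.cast_ne_zero.2 (Nat.multinomial_pos _ _).ne'
  have h2 : (∏ a, ((l a).factorial : ℝ)) ≠ 0 :=
    Finset.prod_ne_zero_iff.2 fun a _ => Nat.cast_ne_zero.2 (Nat.factorial_ne_zero _)
  push_cast
  field_simp

/-- The multi-index `Σ_{i,a} λ_{i,a} e_a`. -/
def totalIndex {A : Type*} [Fintype A] (e : A → Fin n → ℕ) (lam : Fin m → A → ℕ) : Fin n → ℕ :=
  fun j => ∑ i, ∑ a, lam i a * e a j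

/-- The coefficient of the normalized monomial of index `Σ_{i,a} λ_{i,a} e_a` contributed by `λ`
to the composition of a normalized monomial with a polynomial map with coefficients `d`. -/
def compCoeff {A : Type*} [Fintype A] (e : A → Fin n → ℕ) (d : Fin m → A → ℝ)
    (lam : Fin m → A → ℕ) : ℝ :=
  (∏ j, ((totalIndex e lam j).factorial : ℝ)) *
    ∏ i, ∏ a, (d i a / ∏ j, ((e a j).factorial : ℝ)) ^ lam i a / ((lam i a).factorial : ℝ)

lemma taylorMonomial_comp {A : Type*} [Fintype A] [DecidableEq A] (e : A → Fin n → ℕ)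
    (d : Fin m → A → ℝ) (b : Fin m → ℝ) (y : Fin n → ℝ) (γ : Fin m → ℕ) (x : Fin n → ℝ) :
    taylorMonomial b γ (fun i => b i + ∑ a, d i a * taylorMonomial y (e a) x) =
      ∑ lam ∈ Fintype.piFinset (fun i => Finset.piAntidiag Finset.univ (γ i)),
        compCoeff e d lam * taylorMonomial y (totalIndex e lam) x := by
  unfold taylorMonomial
  simp only [add_sub_cancel_left, sum_pow_div_factorial]
  rw [Finset.prod_univ_sum]
  refine Finset.sum_congr rfl fun lam _ => ?_
  have hx : ∏ j, (x j - y j) ^ totalIndex e lam j =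
      ∏ i, ∏ a, (∏ j, (x j - y j) ^ e a j) ^ lam i a := by
    simp only [totalIndex, ← Finset.prod_pow_eq_pow_sum]
    rw [Finset.prod_comm]
    refine Finset.prod_congr rfl fun i _ => ?_
    rw [Finset.prod_comm]
    refine Finset.prod_congr rfl fun a _ => ?_
    rw [← Finset.prod_pow]
    exact Finset.prod_congr rfl fun j _ => by rw [← pow_mul, mul_comm]
  have hw : (∏ j, ((totalIndex e lam j).factorial : ℝ)) ≠ 0 :=
    Finset.prod_ne_zero_iff.2 fun a _ => Nat.cast_ne_zero.2 (Nat.factorial_ne_zero _)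
  rw [compCoeff, Finset.prod_div_distrib (f := fun j => (x j - y j) ^ totalIndex e lam j), hx]
  rw [mul_assoc, mul_comm (∏ j, _), mul_assoc, div_mul_cancel₀ _ hw]
  simp only [← Finset.prod_mul_distrib]
  refine Finset.prod_congr rfl fun i _ => Finset.prod_congr rfl fun a _ => ?_
  rw [Finset.prod_div_distrib, mul_div_assoc', div_pow, div_pow, mul_pow]
  ring

lemma formalPullback_summand {N : ℕ} (D : Fin m → (Fin n → Fin (N + 1)) → ℝ) (g : ℝ)
    (β : Fin n → ℕ) (lam : Fin m → (Fin n → Fin (N + 1)) → ℕ)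
    (hlam : totalIndex (fun a j => (a j : ℕ)) lam = β) :
    (if ∀ i a, (∀ j, (a j : ℕ) = 0) → lam i a = 0 then
      ((∏ j, Nat.factorial (β j) : ℕ) : ℝ) / ((∏ i, ∏ a, Nat.factorial (lam i a) : ℕ) : ℝ) * g *
        ∏ a : Fin n → Fin (N + 1), (∏ i, D i a ^ lam i a) /
          ((∏ j, Nat.factorial (a j) : ℕ) : ℝ) ^ (∑ i, lam i a)
      else 0) =
    g * compCoeff (fun a j => (a j : ℕ))
      (fun i a => if ∀ j, (a j : ℕ) = 0 then 0 else D i a) lam := by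
  unfold compCoeff
  rw [hlam]
  beta_reduce
  split_ifs with h
  · have h1 : ∀ i a, ((if ∀ j, (a j : ℕ) = 0 then 0 else D i a) /
        ∏ j, ((a j : ℕ).factorial : ℝ)) ^ lam i a =
        D i a ^ lam i a / (∏ j, ((a j : ℕ).factorial : ℝ)) ^ lam i a := by
      intro i a
      split_ifs with ha
      · simp [h i a ha]
      · exact div_pow _ _ _
    simp only [h1, ← Finset.prod_pow_eq_pow_sum, Finset.prod_div_distrib]
    rw [Finset.prod_comm (s := Finset.univ (α := Fin n → Fin (N + 1))),
      Finset.prod_comm (s := Finset.univ (α := Fin n → Fin (N + 1)))]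
    push_cast
    ring
  · push Not at h
    obtain ⟨i, a, ha, hl⟩ := h
    rw [Finset.prod_eq_zero (Finset.mem_univ i), mul_zero, mul_zero]
    refine Finset.prod_eq_zero (Finset.mem_univ a) ?_
    rw [if_pos ha, zero_div, zero_pow hl, zero_div]

lemma sum_le_mdeg_totalIndex {A : Type*} [Fintype A] (e : A → Fin n → ℕ)
    (lam : Fin m → A → ℕ) (h : ∀ i a, e a = 0 → lam i a = 0) :
    ∑ i, ∑ a, lam i a ≤ mdeg (totalIndex e lam) := by
  have : mdeg (totalIndex e lam) = ∑ i, ∑ a, lam i a * mdeg (e a) := by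
    simp only [mdeg, totalIndex, Finset.mul_sum]
    rw [Finset.sum_comm]
    exact Finset.sum_congr rfl fun i _ => Finset.sum_comm
  rw [this]
  refine Finset.sum_le_sum fun i _ => Finset.sum_le_sum fun a _ => ?_
  by_cases ha : e a = 0
  · rw [h i a ha, zero_mul]
  · exact Nat.le_mul_of_pos_right _ (Nat.pos_of_ne_zero fun h0 => ha (mdeg_eq_zero.1 h0))

/-- **Faà di Bruno's formula**: on jets of smooth functions the formal pullback is
composition. -/
theorem formalPullback_mpd {φ : (Fin n → ℝ) → (Fin m → ℝ)} (hφ : ContDiff ℝ ∞ φ)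
    {G : (Fin m → ℝ) → ℝ} (hG : ContDiff ℝ ∞ G) (β : Fin n → ℕ) (y : Fin n → ℝ) :
    formalPullback φ (fun γ => mpd γ G) β y = mpd β (fun x => G (φ x)) y := by
  set N := mdeg β
  have hφj := contDiff_pi.1 hφ
  let e : (Fin n → Fin (N + 1)) → Fin n → ℕ := fun a j => a j
  let D : Fin m → (Fin n → Fin (N + 1)) → ℝ := fun i a => mpd (e a) (fun x => φ x i) y
  let d : Fin m → (Fin n → Fin (N + 1)) → ℝ := fun i a => if ∀ j, (a j : ℕ) = 0 then 0 else D i a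
  let P : (Fin n → ℝ) → (Fin m → ℝ) := fun x i => φ y i + ∑ a, d i a * taylorMonomial y (e a) x
  have hP' : ∀ i x, P x i = ∑ a, D i a * taylorMonomial y (e a) x := by
    intro i x
    simp only [P]
    rw [← Finset.add_sum_erase _ _ (Finset.mem_univ (0 : Fin n → Fin (N + 1))),
      ← Finset.add_sum_erase _ _ (Finset.mem_univ (0 : Fin n → Fin (N + 1)))]
    have h0 : e 0 = 0 := rfl
    rw [h0, taylorMonomial_zero]
    simp only [d, D, h0, mpd_zero]
    simp only [Pi.zero_apply, Fin.val_zero, implies_true, if_true, zero_add, mul_one]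
    congr 1
    refine Finset.sum_congr rfl fun a ha => ?_
    rw [if_neg]
    intro h
    exact Finset.ne_of_mem_erase ha (funext fun j => Fin.ext (h j))
  have hPs : ContDiff ℝ ∞ P := contDiff_pi.2 fun i =>
    contDiff_const.add (ContDiff.sum fun a _ => contDiff_const.mul (contDiff_taylorMonomial y _))
  have hφP : ∀ i, JetEq N y (fun x => φ x i) (fun x => P x i) := by
    intro i α hα
    simp only [hP']
    rw [mpd_sum_const_mul _ _ fun a _ => contDiff_taylorMonomial y (e a)]
    simp only [mpd_taylorMonomial_self]
    rw [Finset.sum_eq_single fun j => ⟨α j, Nat.lt_succ_of_le ((le_mdeg α j).trans hα)⟩]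
    · have : e (fun j => ⟨α j, Nat.lt_succ_of_le ((le_mdeg α j).trans hα)⟩) = α := rfl
      simp only [D, this, if_true, mul_one]
    · intro a _ ha
      rw [if_neg, mul_zero]
      rintro rfl
      exact ha rfl
    · simp
  have hQ : JetEq N (φ y) G (jetTaylorPoly N (φ y) fun γ => mpd γ G) :=
    fun α hα => (mpd_jetTaylorPoly_self (φ y) (fun γ => mpd γ G) hα).symm
  rw [JetEq.comp hG (contDiff_jetTaylorPoly _ _ _) hφ hPs hQ hφP β le_rfl, jetTaylorPoly_eq_sum]
  have hexp : ∀ γ x, taylorMonomial (φ y) γ (P x) = _ :=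
    fun γ x => taylorMonomial_comp e d (φ y) y γ x
  simp only [hexp]
  rw [mpd_sum_const_mul _ _ fun γ _ => ContDiff.sum fun lam _ =>
    contDiff_const.mul (contDiff_taylorMonomial y (totalIndex e lam))]
  simp only [mpd_sum_const_mul _ _ fun lam _ => contDiff_taylorMonomial y (totalIndex e lam),
    mpd_taylorMonomial_self, Finset.mul_sum]
  rw [Finset.sum_sigma']
  have hL : formalPullback φ (fun γ => mpd γ G) β y =
      ∑ lam : Fin m → (Fin n → Fin (N + 1)) → Fin (N + 1),
        if totalIndex e (fun i a => (lam i a : ℕ)) = β then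
          mpd (fun i => ∑ a, (lam i a : ℕ)) G (φ y) * compCoeff e d (fun i a => (lam i a : ℕ))
        else 0 := by
    unfold formalPullback
    refine Finset.sum_congr rfl fun lam _ => ?_
    have hiff : (∀ j : Fin n, (∑ i, ∑ a : Fin n → Fin (mdeg β + 1), (lam i a : ℕ) * (a j : ℕ)) = β j)
        ↔ totalIndex e (fun i a => (lam i a : ℕ)) = β := by
      rw [funext_iff]
      rfl
    by_cases h : totalIndex e (fun i a => (lam i a : ℕ)) = β
    · rw [if_pos h]
      exact (if_congr (and_iff_left (hiff.2 h)) rfl rfl).trans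
        (formalPullback_summand D _ β _ h)
    · rw [if_neg fun h' => h (hiff.1 h'.2), if_neg h]
  rw [hL]
  have hvanish : ∀ lam : Fin m → (Fin n → Fin (N + 1)) → ℕ, compCoeff e d lam ≠ 0 →
      ∀ i a, e a = 0 → lam i a = 0 := by
    intro lam h i a ha
    by_contra hl
    refine h ?_
    rw [compCoeff, Finset.prod_eq_zero (Finset.mem_univ i), mul_zero]
    refine Finset.prod_eq_zero (Finset.mem_univ a) ?_
    have : d i a = 0 := if_pos fun j => congrFun ha j
    rw [this, zero_div, zero_pow hl, zero_div]
  refine Finset.sum_bij_ne_zero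
    (fun lam _ _ => ⟨fun i => ∑ a, (lam i a : ℕ), fun i a => (lam i a : ℕ)⟩) ?_ ?_ ?_ ?_
  · intro lam _ hne
    have hw : totalIndex e (fun i a => (lam i a : ℕ)) = β := by
      by_contra h
      exact hne (if_neg h)
    rw [if_pos hw] at hne
    have := sum_le_mdeg_totalIndex e _ (hvanish _ (right_ne_zero_of_mul hne))
    rw [hw] at this
    simp only [Finset.mem_sigma, mem_multiIndices, Fintype.mem_piFinset, Finset.mem_piAntidiag]
    exact ⟨this, by simp⟩
  · intro lam _ _ lam' _ _ h
    have := congrFun₂ (eq_of_heq (Sigma.mk.inj h).2)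
    exact funext₂ fun i a => Fin.ext (this i a)
  · rintro ⟨γ, lam⟩ hmem hne
    simp only [Finset.mem_sigma, mem_multiIndices, Fintype.mem_piFinset,
      Finset.mem_piAntidiag] at hmem hne
    have hw : totalIndex e lam = β := by
      by_contra h
      exact hne (by rw [if_neg h, mul_zero, mul_zero])
    rw [if_pos hw, mul_one] at hne
    have hle := sum_le_mdeg_totalIndex e _ (hvanish _ (right_ne_zero_of_mul hne))
    rw [hw] at hle
    have hlt : ∀ i a, lam i a < N + 1 := fun i a => Nat.lt_succ_of_le <|
      ((Finset.single_le_sum (f := fun a => lam i a) (fun _ _ => Nat.zero_le _)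
        (Finset.mem_univ a)).trans (Finset.single_le_sum (f := fun i => ∑ a, lam i a)
        (fun _ _ => Nat.zero_le _) (Finset.mem_univ i))).trans hle
    have hγ : (fun i => ∑ a, lam i a) = γ := funext fun i => (hmem.2 i).1
    subst hγ
    refine ⟨fun i a => ⟨lam i a, hlt i a⟩, Finset.mem_univ _, ?_, rfl⟩
    rw [if_pos hw]
    exact hne
  · intro lam _ hne
    have hw : totalIndex e (fun i a => (lam i a : ℕ)) = β := by
      by_contra h
      exact hne (if_neg h)
    simp only [hw, if_true, mul_one]

end FaaDiBruno

section UniformRemainders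

variable {n m : ℕ}

/-- `r(x, y) = o(|x - y|^p)` uniformly for `x, y ∈ K` as `|x - y| → 0`. -/
def UnifLittleO (K : Set (Fin n → ℝ)) (p : ℕ) (r : (Fin n → ℝ) → (Fin n → ℝ) → ℝ) : Prop :=
  ∀ ε > 0, ∃ δ > 0, ∀ x ∈ K, ∀ y ∈ K, dist x y < δ → |r x y| ≤ ε * dist x y ^ p

lemma UnifLittleO.add {K : Set (Fin n → ℝ)} {p : ℕ} {r s : (Fin n → ℝ) → (Fin n → ℝ) → ℝ}
    (hr : UnifLittleO K p r) (hs : UnifLittleO K p s) :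
    UnifLittleO K p (fun x y => r x y + s x y) := by
  intro ε hε
  obtain ⟨δ, hδ, h⟩ := hr (ε / 2) (half_pos hε)
  obtain ⟨δ', hδ', h'⟩ := hs (ε / 2) (half_pos hε)
  refine ⟨min δ δ', lt_min hδ hδ', fun x hx y hy hxy => ?_⟩
  have h1 := h x hx y hy (hxy.trans_le (min_le_left _ _))
  have h2 := h' x hx y hy (hxy.trans_le (min_le_right _ _))
  linarith [abs_add_le (r x y) (s x y)]

lemma UnifLittleO.bdd_mul {K : Set (Fin n → ℝ)} {p : ℕ}
    {c r : (Fin n → ℝ) → (Fin n → ℝ) → ℝ} {C : ℝ} (hc : ∀ x ∈ K, ∀ y ∈ K, |c x y| ≤ C)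
    (hr : UnifLittleO K p r) : UnifLittleO K p (fun x y => c x y * r x y) := by
  intro ε hε
  obtain ⟨δ, hδ, h⟩ := hr (ε / (|C| + 1)) (by positivity)
  refine ⟨δ, hδ, fun x hx y hy hxy => ?_⟩
  have hC : |c x y| ≤ |C| + 1 := (hc x hx y hy).trans ((le_abs_self C).trans (by linarith))
  calc |c x y * r x y| = |c x y| * |r x y| := abs_mul _ _
    _ ≤ (|C| + 1) * (ε / (|C| + 1) * dist x y ^ p) :=
        mul_le_mul hC (h x hx y hy hxy) (abs_nonneg _) (by positivity)
    _ = ε * dist x y ^ p := by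
        field_simp

lemma UnifLittleO.sum {ι : Type*} {K : Set (Fin n → ℝ)} {p : ℕ} (s : Finset ι)
    {r : ι → (Fin n → ℝ) → (Fin n → ℝ) → ℝ} (hr : ∀ j ∈ s, UnifLittleO K p (r j)) :
    UnifLittleO K p (fun x y => ∑ j ∈ s, r j x y) := by
  classical
  induction s using Finset.induction_on with
  | empty =>
    refine fun ε hε => ⟨1, one_pos, fun x _ y _ _ => ?_⟩
    simp only [Finset.sum_empty, abs_zero]
    positivity
  | insert j s hj ih =>
    simp only [Finset.sum_insert hj]
    exact (hr j (Finset.mem_insert_self j s)).add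
      (ih fun i hi => hr i (Finset.mem_insert_of_mem hi))

lemma jetTaylorPoly_sum_const_mul {ι : Type*} (s : Finset ι) (c : ι → ℝ) (F : ι → Jet n)
    (k : ℕ) (a : Fin n → ℝ) :
    jetTaylorPoly k a (fun α x => ∑ j ∈ s, c j * F j α x) =
      fun x => ∑ j ∈ s, c j * jetTaylorPoly k a (F j) x := by
  ext x
  simp only [jetTaylorPoly_eq_sum, Finset.mul_sum, Finset.sum_mul]
  rw [Finset.sum_comm]
  simp only [mul_assoc]

lemma jetRem_sum_const_mul {ι : Type*} (s : Finset ι) (c : ι → ℝ) (F : ι → Jet n)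
    (k : ℕ) (a : Fin n → ℝ) (β : Fin n → ℕ) (y : Fin n → ℝ) :
    jetRem k a (fun α x => ∑ j ∈ s, c j * F j α x) β y = ∑ j ∈ s, c j * jetRem k a (F j) β y := by
  simp only [jetRem, jetTaylorPoly_sum_const_mul, mul_sub, Finset.sum_sub_distrib]
  rw [mpd_sum_const_mul s c fun j _ => contDiff_jetTaylorPoly k a (F j)]

lemma unifLittleO_jetRem_sum {ι : Type*} {K : Set (Fin n → ℝ)} (hK : IsCompact K) (s : Finset ι)
    {c f : ι → (Fin n → ℝ) → ℝ} (hc : ∀ j ∈ s, ContinuousOn (c j) K)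
    (hf : ∀ j ∈ s, ContDiff ℝ ∞ (f j)) {k : ℕ} {β : Fin n → ℕ} (hβ : mdeg β ≤ k) :
    UnifLittleO K (k - mdeg β)
      (fun x y => jetRem k x (fun α => mpd α (fun z => ∑ j ∈ s, c j x * f j z)) β y) := by
  simp only [mpd_sum_const_mul s _ hf, jetRem_sum_const_mul]
  refine UnifLittleO.sum s fun j hj => ?_
  obtain ⟨C, hC⟩ := hK.exists_bound_of_continuousOn (hc j hj)
  refine UnifLittleO.bdd_mul (c := fun x _ => c j x) (fun x hx _ _ => hC x hx) fun ε hε => ?_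
  obtain ⟨δ, hδ, h⟩ := whitneyCond_mpd hK k (hf j hj) hβ hε
  exact ⟨δ, hδ, fun x hx y _ => h x hx y⟩

lemma taylorMonomial_eq_sum (b : Fin m → ℝ) (γ : Fin m → ℕ) (u : Fin m → ℝ) :
    taylorMonomial b γ u = ∑ q ∈ Fintype.piFinset fun i => Finset.range (γ i + 1),
      taylorMonomial b (γ - q) 0 * taylorMonomial 0 q u := by
  unfold taylorMonomial
  have h : ∀ i, (u i - b i) ^ γ i / ((γ i).factorial : ℝ) = ∑ q ∈ Finset.range (γ i + 1),
      ((0 - b i) ^ (γ i - q) / ((γ i - q).factorial : ℝ)) *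
        ((u i - 0) ^ q / (q.factorial : ℝ)) := by
    intro i
    rw [sub_eq_add_neg, add_pow, Finset.sum_div]
    refine Finset.sum_congr rfl fun q hq => ?_
    rw [Nat.cast_choose ℝ (Nat.lt_succ_iff.1 (Finset.mem_range.1 hq)), zero_sub, sub_zero]
    field_simp
  simp only [h]
  rw [Finset.prod_univ_sum]
  simp only [Finset.prod_mul_distrib, Pi.sub_apply, Pi.zero_apply]

lemma continuous_taylorMonomial_base (γ : Fin m → ℕ) (u : Fin m → ℝ) :
    Continuous fun b => taylorMonomial b γ u := by
  unfold taylorMonomial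
  fun_prop

lemma unifLittleO_jetRem_comp {K : Set (Fin n → ℝ)} (hK : IsCompact K)
    {φ : (Fin n → ℝ) → (Fin m → ℝ)} (hφ : ContDiff ℝ ∞ φ) {k : ℕ} {F : Jet m}
    (hF : ∀ γ, mdeg γ ≤ k → ContinuousOn (F γ) (φ '' K)) {β : Fin n → ℕ} (hβ : mdeg β ≤ k) :
    UnifLittleO K (k - mdeg β) (fun x y =>
      jetRem k x (fun α => mpd α (fun z => jetTaylorPoly k (φ x) F (φ z))) β y) := by
  have hexp : ∀ x z, jetTaylorPoly k (φ x) F (φ z) =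
      ∑ j ∈ (multiIndices m k).sigma fun γ => Fintype.piFinset fun i => Finset.range (γ i + 1),
        F j.1 (φ x) * taylorMonomial (φ x) (j.1 - j.2) 0 * taylorMonomial 0 j.2 (φ z) := by
    intro x z
    rw [Finset.sum_sigma, jetTaylorPoly_eq_sum]
    refine Finset.sum_congr rfl fun γ _ => ?_
    rw [taylorMonomial_eq_sum (φ x) γ (φ z), Finset.mul_sum]
    simp only [mul_assoc]
  simp only [hexp]
  refine unifLittleO_jetRem_sum hK _
    (c := fun (j : (_ : Fin m → ℕ) × (Fin m → ℕ)) x =>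
      F j.1 (φ x) * taylorMonomial (φ x) (j.1 - j.2) 0)
    (f := fun (j : (_ : Fin m → ℕ) × (Fin m → ℕ)) z => taylorMonomial 0 j.2 (φ z))
    (fun j hj => ?_) (fun j _ => ?_) hβ
  · have hγ := mem_multiIndices.1 (Finset.mem_sigma.1 hj).1
    exact ((hF _ hγ).comp hφ.continuous.continuousOn (Set.mapsTo_image φ K)).mul
      ((continuous_taylorMonomial_base _ _).comp hφ.continuous).continuousOn
  · exact (contDiff_taylorMonomial 0 j.2).comp hφ

end UniformRemainders

section Pullback

variable {n m : ℕ}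

lemma formalPullback_eq_sum {φ : (Fin n → ℝ) → (Fin m → ℝ)} (hφ : ContDiff ℝ ∞ φ)
    (β : Fin n → ℕ) :
    ∃ (s : Finset (Fin m → (Fin n → Fin (mdeg β + 1)) → Fin (mdeg β + 1)))
      (γ : (Fin m → (Fin n → Fin (mdeg β + 1)) → Fin (mdeg β + 1)) → Fin m → ℕ)
      (c : (Fin m → (Fin n → Fin (mdeg β + 1)) → Fin (mdeg β + 1)) → (Fin n → ℝ) → ℝ),
      (∀ l ∈ s, mdeg (γ l) ≤ mdeg β) ∧ (∀ l, Continuous (c l)) ∧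
        ∀ F x, formalPullback φ F β x = ∑ l ∈ s, c l x * F (γ l) (φ x) := by
  refine ⟨Finset.univ.filter fun lam => (∀ i a, (∀ j, (a j : ℕ) = 0) → (lam i a : ℕ) = 0) ∧
      (∀ j : Fin n, (∑ i, ∑ a : Fin n → Fin (mdeg β + 1), (lam i a : ℕ) * (a j : ℕ)) = β j),
    fun lam i => ∑ a : Fin n → Fin (mdeg β + 1), (lam i a : ℕ),
    fun lam x => ((∏ j, Nat.factorial (β j) : ℕ) : ℝ)
            / ((∏ i, ∏ a : Fin n → Fin (mdeg β + 1), Nat.factorial (lam i a) : ℕ) : ℝ)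
          * ∏ a : Fin n → Fin (mdeg β + 1),
              (∏ i, (mpd (fun j => (a j : ℕ)) (fun y => φ y i) x) ^ ((lam i a : ℕ)))
                / ((∏ j, Nat.factorial (a j) : ℕ) : ℝ) ^ (∑ i, (lam i a : ℕ)),
    fun lam hlam => ?_, fun lam => ?_, fun F x => ?_⟩
  · obtain ⟨h0, hβ⟩ := (Finset.mem_filter.1 hlam).2
    have h := sum_le_mdeg_totalIndex (fun (a : Fin n → Fin (mdeg β + 1)) j => (a j : ℕ))
      (fun i a => (lam i a : ℕ)) fun i a ha => h0 i a (congrFun ha)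
    rwa [show totalIndex (fun (a : Fin n → Fin (mdeg β + 1)) j => (a j : ℕ))
      (fun i a => (lam i a : ℕ)) = β from funext hβ] at h
  · have hc : ∀ (a : Fin n → Fin (mdeg β + 1)) i,
        Continuous (mpd (fun j => (a j : ℕ)) (fun y => φ y i)) :=
      fun a i => (contDiff_mpd (contDiff_pi.1 hφ i) _).continuous
    refine continuous_const.mul (continuous_finsetProd _ fun a _ => ?_)
    exact (continuous_finsetProd _ fun i _ => (hc a i).pow _).div_const _
  · unfold formalPullback
    rw [Finset.sum_filter]
    refine Finset.sum_congr rfl fun lam _ => if_congr Iff.rfl ?_ rfl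
    ring

lemma formalPullback_congr_nhds {φ ψ : (Fin n → ℝ) → (Fin m → ℝ)} {x : Fin n → ℝ}
    (h : φ =ᶠ[𝓝 x] ψ) (F : Jet m) (β : Fin n → ℕ) :
    formalPullback φ F β x = formalPullback ψ F β x := by
  have hm : ∀ α i, mpd α (fun y => φ y i) x = mpd α (fun y => ψ y i) x := fun α i =>
    (mpd_congr_nhds (h.mono fun y hy => congrFun hy i) α).self_of_nhds
  unfold formalPullback
  simp only [hm, h.self_of_nhds]

lemma jetRem_apply (k : ℕ) (a : Fin n → ℝ) (F : Jet n) (α : Fin n → ℕ) (x : Fin n → ℝ) :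
    jetRem k a F α x = F α x - mpd α (jetTaylorPoly k a F) x :=
  rfl

lemma jetRem_formalPullback {φ : (Fin n → ℝ) → (Fin m → ℝ)} (hφ : ContDiff ℝ ∞ φ) (F : Jet m)
    (k : ℕ) (β : Fin n → ℕ) (x y : Fin n → ℝ) :
    jetRem k x (formalPullback φ F) β y =
      formalPullback φ (jetRem k (φ x) F) β y +
        jetRem k x (fun α => mpd α (fun z => jetTaylorPoly k (φ x) F (φ z))) β y := by
  have hG := contDiff_jetTaylorPoly k (φ x) F
  have hT : jetTaylorPoly k x (formalPullback φ F) =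
      jetTaylorPoly k x (fun α => mpd α (fun z => jetTaylorPoly k (φ x) F (φ z))) := by
    refine jetTaylorPoly_congr fun α hα => ?_
    rw [← formalPullback_mpd hφ hG]
    obtain ⟨s, γ, c, hγ, -, h⟩ := formalPullback_eq_sum hφ α
    rw [h, h]
    exact Finset.sum_congr rfl fun l hl => by
      rw [mpd_jetTaylorPoly_self _ _ ((hγ l hl).trans hα)]
  obtain ⟨s, γ, c, -, -, h⟩ := formalPullback_eq_sum hφ β
  rw [jetRem_apply k x, jetRem_apply k x, hT, ← formalPullback_mpd hφ hG β y, h, h, h]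
  simp only [jetRem_apply, mul_sub, Finset.sum_sub_distrib]
  ring

lemma unifLittleO_jetRem_image {K : Set (Fin n → ℝ)} {φ : (Fin n → ℝ) → (Fin m → ℝ)}
    {L : NNReal} (hL : LipschitzWith L φ) {k : ℕ} {F : Jet m} (hK : IsCompact (φ '' K))
    (hF : WhitneyCond k (φ '' K) F) {γ : Fin m → ℕ} {p : ℕ} (hγ : mdeg γ ≤ k)
    (hp : p ≤ k - mdeg γ) :
    UnifLittleO K p (fun x y => jetRem k (φ x) F γ (φ y)) := by
  intro ε hε
  set q := k - mdeg γ with hq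
  have hL0 : (0 : ℝ) < L + 1 := by positivity
  obtain ⟨δ, hδ, h⟩ := hF _ subset_rfl hK γ hγ (ε / (L + 1) ^ q) (by positivity)
  refine ⟨min 1 (δ / (L + 1)), by positivity, fun x hx y hy hxy => ?_⟩
  by_cases hne : φ x = φ y
  · beta_reduce
    rw [jetRem_apply, hne, mpd_jetTaylorPoly_self _ _ hγ, sub_self, abs_zero]
    positivity
  have hd : dist (φ x) (φ y) ≤ (L + 1) * dist x y :=
    (hL.dist_le_mul x y).trans (by gcongr; linarith)
  have hlt : dist (φ x) (φ y) < δ := by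
    refine hd.trans_lt ?_
    rw [mul_comm, ← lt_div_iff₀ hL0]
    exact hxy.trans_le (min_le_right _ _)
  calc |jetRem k (φ x) F γ (φ y)|
      ≤ ε / (L + 1) ^ q * dist (φ x) (φ y) ^ q :=
        h _ (Set.mem_image_of_mem φ hx) _ (Set.mem_image_of_mem φ hy) hne hlt
    _ ≤ ε / (L + 1) ^ q * ((L + 1) * dist x y) ^ q := by gcongr
    _ = ε * dist x y ^ q := by
        rw [mul_pow]
        field_simp
    _ ≤ ε * dist x y ^ p := by
        refine mul_le_mul_of_nonneg_left ?_ hε.le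
        exact pow_le_pow_of_le_one dist_nonneg (hxy.le.trans (min_le_left _ _)) hp

lemma unifLittleO_jetRem_formalPullback {K : Set (Fin n → ℝ)} (hK : IsCompact K)
    {φ : (Fin n → ℝ) → (Fin m → ℝ)} (hφ : ContDiff ℝ ∞ φ) {L : NNReal} (hL : LipschitzWith L φ)
    {k : ℕ} {F : Jet m} (hFc : ∀ γ, mdeg γ ≤ k → ContinuousOn (F γ) (φ '' K))
    (hF : WhitneyCond k (φ '' K) F) {β : Fin n → ℕ} (hβ : mdeg β ≤ k) :
    UnifLittleO K (k - mdeg β) (fun x y => jetRem k x (formalPullback φ F) β y) := by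
  simp only [jetRem_formalPullback hφ F]
  suffices h : UnifLittleO K (k - mdeg β)
      (fun x y => formalPullback φ (jetRem k (φ x) F) β y) from
    h.add (unifLittleO_jetRem_comp hK hφ hFc hβ)
  obtain ⟨s, γ, c, hγ, hc, h⟩ := formalPullback_eq_sum hφ β
  simp only [h]
  refine UnifLittleO.sum s fun l hl => ?_
  obtain ⟨C, hC⟩ := hK.exists_bound_of_continuousOn (hc l).continuousOn
  exact UnifLittleO.bdd_mul (c := fun _ y => c l y) (fun _ _ y hy => hC y hy)
    (unifLittleO_jetRem_image hL (hK.image hφ.continuous) hF ((hγ l hl).trans hβ)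
      (Nat.sub_le_sub_left (hγ l hl) k))

open scoped Manifold in
/-- A map that is smooth on an open set agrees near any compact subset with a globally smooth,
globally Lipschitz map. -/
lemma exists_contDiff_lipschitz_eq_near {E F : Type*} [NormedAddCommGroup E] [NormedSpace ℝ E]
    [FiniteDimensional ℝ E] [NormedAddCommGroup F] [NormedSpace ℝ F] {φ : E → F} {U K : Set E}
    (hU : IsOpen U) (hφ : ContDiffOn ℝ ∞ φ U) (hK : IsCompact K) (hKU : K ⊆ U) :
    ∃ (ψ : E → F) (L : NNReal), ContDiff ℝ ∞ ψ ∧ LipschitzWith L ψ ∧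
      ∀ x ∈ K, φ =ᶠ[𝓝 x] ψ := by
  obtain ⟨T, hT, hKT, hTU⟩ := exists_compact_between hK hU hKU
  obtain ⟨χ, h1, h0, -⟩ := exists_contMDiffMap_one_nhds_of_subset_interior (n := (⊤ : ℕ∞)) 𝓘(ℝ, E)
    hK.isClosed hKT
  have hχ : ContDiff ℝ ∞ χ := χ.contMDiff.contDiff
  have hψ : ContDiff ℝ ∞ (fun x => χ x • φ x) := by
    rw [contDiff_iff_contDiffAt]
    intro x
    by_cases hx : x ∈ U
    · exact hχ.contDiffAt.smul (hφ.contDiffAt (hU.mem_nhds hx))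
    · refine (contDiffAt_const (c := (0 : F))).congr_of_eventuallyEq ?_
      filter_upwards [hT.isClosed.isOpen_compl.mem_nhds fun h => hx (hTU h)] with y hy
      rw [h0 y hy, zero_smul]
  have hsupp : HasCompactSupport (fun x => χ x • φ x) :=
    HasCompactSupport.intro hT fun x hx => by rw [h0 x hx, zero_smul]
  obtain ⟨L, hL⟩ := hψ.lipschitzWith_of_hasCompactSupport hsupp (by simp)
  refine ⟨_, L, hψ, hL, fun x hx => ?_⟩
  filter_upwards [h1.filter_mono (nhds_le_nhdsSet hx)] with y hy
  rw [hy, one_smul]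

end Pullback

/-- the formal pullback maps Whitney functions to Whitney functions,
for every order `m' ∈ ℕ ∪ {∞}`. -/
theorem formalPullback_whitney
    {n m : ℕ} (U : Set (Fin n → ℝ)) (V : Set (Fin m → ℝ))
    (hU : IsOpen U) (hV : IsOpen V)
    (X : Set (Fin n → ℝ)) (Y : Set (Fin m → ℝ))
    (hXU : X ⊆ U) (hYV : Y ⊆ V)
    (hXcl : ∃ C : Set (Fin n → ℝ), IsClosed C ∧ X = C ∩ U)
    (hYcl : ∃ C : Set (Fin m → ℝ), IsClosed C ∧ Y = C ∩ V)
    (φ : (Fin n → ℝ) → (Fin m → ℝ)) (hφ : ContDiffOn ℝ (⊤ : ℕ∞) φ U)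
    (hφXY : Set.MapsTo φ X Y)
    (m' : ℕ∞) (F : Jet m)
    (hFcont : ∀ γ : Fin m → ℕ, (mdeg γ : ℕ∞) ≤ m' → ContinuousOn (F γ) Y)
    (hFW : IsWhitneyOn m' Y F) :
    IsWhitneyOn m' X (formalPullback φ F) := by
  intro k hk K hKX hK β hβ ε hε
  have hkm : (k : ℕ∞) ≤ m' := by
    rcases hk with rfl | rfl
    · exact le_rfl
    · exact le_top
  obtain ⟨ψ, L, hψ, hL, hφψ⟩ := exists_contDiff_lipschitz_eq_near hU hφ hK (hKX.trans hXU)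
  have himage : ψ '' K ⊆ Y := by
    rintro _ ⟨x, hx, rfl⟩
    rw [← (hφψ x hx).self_of_nhds]
    exact hφXY (hKX hx)
  have hpull : ∀ x ∈ K, ∀ α, formalPullback φ F α x = formalPullback ψ F α x :=
    fun x hx α => formalPullback_congr_nhds (hφψ x hx) F α
  obtain ⟨δ, hδ, h⟩ := unifLittleO_jetRem_formalPullback hK hψ hL
    (fun γ hγ => (hFcont γ (le_trans (mod_cast hγ) hkm)).mono himage)
    (fun K' hK' => hFW k hk K' (hK'.trans himage)) hβ ε hε
  refine ⟨δ, hδ, fun x hx y hy _ hxy => ?_⟩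
  rw [jetRem_apply, hpull y hy, jetTaylorPoly_congr fun α _ => hpull x hx α]
  exact h x hx y hy hxy
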